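/- Let Ω ⊂ ℝ² be an open set part of whose boundary is an open straight segment T with endpoints A and B, with constant outer unit normal ν along T, oriented so that ν is the right-hand normal to the direction (B−A)/|B−A|. Let u be a C² solution of the minimal surfaces equation in Ω such that u(x) → +∞ as x → z for every z ∈ T. Then the inward flux of the normalized gradient across T equals the length of T: lim_{ε→0⁺} ∫_{[A−εν, B−εν]} ⟨∇u(x), ν⟩ / W(x) ds(x) = |B − A|, where the integral is with respect to arclength on the translated segment (which lies in Ω for small ε). -/

import Mathlib

open Real Filter Set Topology MeasureTheory

/-- Partial derivative in the first (x) variable. -/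
noncomputable def pd1 (u : ℝ × ℝ → ℝ) (z : ℝ × ℝ) : ℝ := deriv (fun t => u (t, z.2)) z.1

/-- Partial derivative in the second (y) variable. -/
noncomputable def pd2 (u : ℝ × ℝ → ℝ) (z : ℝ × ℝ) : ℝ := deriv (fun t => u (z.1, t)) z.2

/-- `W = √(1 + p² + q²)` for the function `u`. -/
noncomputable def Wg (u : ℝ × ℝ → ℝ) (z : ℝ × ℝ) : ℝ :=
  Real.sqrt (1 + pd1 u z ^ 2 + pd2 u z ^ 2)

/-- `u` is a C² solution of the minimal surfaces equation
`(1+q²)r − 2pq·s + (1+p²)t = 0` on `Ω`. -/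
def IsMSE (u : ℝ × ℝ → ℝ) (Ω : Set (ℝ × ℝ)) : Prop :=
  ContDiffOn ℝ 2 u Ω ∧ ∀ z ∈ Ω,
    (1 + pd2 u z ^ 2) * pd1 (pd1 u) z
      - 2 * pd1 u z * pd2 u z * pd2 (pd1 u) z
      + (1 + pd1 u z ^ 2) * pd2 (pd2 u) z = 0

/-- Euclidean length of a planar vector. -/
noncomputable def len (v : ℝ × ℝ) : ℝ := Real.sqrt (v.1 ^ 2 + v.2 ^ 2)

/-- Euclidean open disk in the plane. -/
def eball (P : ℝ × ℝ) (ρ : ℝ) : Set (ℝ × ℝ) := {z | len (z - P) < ρ}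


lemma core_ineq (U X Y D : ℝ × ℝ → ℝ) (U' X' Y' : ℝ × ℝ → (ℝ × ℝ →L[ℝ] ℝ)) (L e0 : ℝ) (hL : 0 < L)
    (hU : ∀ z ∈ Icc (0:ℝ) 1 ×ˢ Ioo 0 e0, HasFDerivAt U (U' z) z)
    (hX : ∀ z ∈ Icc (0:ℝ) 1 ×ˢ Ioo 0 e0, HasFDerivAt X (X' z) z)
    (hY : ∀ z ∈ Icc (0:ℝ) 1 ×ˢ Ioo 0 e0, HasFDerivAt Y (Y' z) z)
    (hdiv : ∀ z ∈ Icc (0:ℝ) 1 ×ˢ Ioo 0 e0, X' z (1, 0) = L * Y' z (0, 1))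
    (hD : ∀ z ∈ Icc (0:ℝ) 1 ×ˢ Ioo 0 e0,
      D z = U' z (1, 0) * X z + L * U' z (0, 1) * (1 - Y z))
    (hDc : ContinuousOn D (Icc (0:ℝ) 1 ×ˢ Ioo 0 e0))
    (hDl : ∀ z ∈ Icc (0:ℝ) 1 ×ˢ Ioo 0 e0, -L ≤ D z)
    (hX1 : ∀ z, |X z| ≤ 1)
    (a b δ h N : ℝ) (ha : 0 ≤ a) (hab : a ≤ b) (hb : b ≤ 1) (hδ : 0 < δ) (hδh : δ ≤ h)
    (hh : h < e0) (hN : 0 < N) :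
    ∫ s in a..b, L * (arctan (U (s, δ) / N) * (1 - Y (s, δ))) ≤
      (∫ s in a..b, L * (arctan (U (s, h) / N) * (1 - Y (s, h)))) + 4 * (h - δ)
        + L / N * ((b - a) * (h - δ)) := by
  have hsub : Icc (a, δ) (b, h) ⊆ Icc (0:ℝ) 1 ×ˢ Ioo 0 e0 := by
    rintro ⟨x, y⟩ ⟨⟨h1, h2⟩, h3, h4⟩
    simp only at h1 h2 h3 h4
    exact ⟨⟨by linarith, by linarith⟩, by simp only; linarith, by simp only; linarith⟩
  have hsub' : Ioo a b ×ˢ Ioo δ h ⊆ Icc (0:ℝ) 1 ×ˢ Ioo 0 e0 := by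
    rintro ⟨x, y⟩ ⟨⟨h1, h2⟩, h3, h4⟩
    simp only at h1 h2 h3 h4
    exact ⟨⟨by simp only; linarith, by simp only; linarith⟩, by simp only; linarith, by simp only; linarith⟩
  have hg : ∀ z ∈ Icc (0:ℝ) 1 ×ˢ Ioo 0 e0, HasFDerivAt (fun z => arctan (U z / N))
      ((1 / (1 + (U z / N) ^ 2)) • ((1 / N) • U' z)) z := by
    intro z hz
    have := ((hU z hz).mul_const (1 / N)).arctan
    simpa [div_eq_mul_inv] using this
  set f : ℝ × ℝ → ℝ := fun z => arctan (U z / N) * X z with hf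
  set k : ℝ × ℝ → ℝ := fun z => L * (arctan (U z / N) * (1 - Y z)) with hk
  have hf' : ∀ z ∈ Icc (0:ℝ) 1 ×ˢ Ioo 0 e0, HasFDerivAt f _ z :=
    fun z hz => (hg z hz).mul (hX z hz)
  have hk' : ∀ z ∈ Icc (0:ℝ) 1 ×ˢ Ioo 0 e0, HasFDerivAt k _ z :=
    fun z hz => ((hg z hz).mul ((hY z hz).const_sub 1)).const_mul L
  have hUc : ContinuousOn U (Icc (0:ℝ) 1 ×ˢ Ioo 0 e0) :=
    fun z hz => (hU z hz).continuousAt.continuousWithinAt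
  set E : ℝ × ℝ → ℝ := fun z => (1 / (1 + (U z / N) ^ 2)) * (1 / N) * D z with hE
  have hEc : ContinuousOn E (Icc (0:ℝ) 1 ×ˢ Ioo 0 e0) := by
    refine ContinuousOn.mul (ContinuousOn.mul (ContinuousOn.div continuousOn_const ?_ ?_)
      continuousOn_const) hDc
    · exact continuousOn_const.add ((hUc.div_const N).pow 2)
    · intro z _; positivity
  have hEi : IntegrableOn E (Icc (a, δ) (b, h)) :=
    (hEc.mono hsub).integrableOn_compact isCompact_Icc
  have key := integral_divergence_prod_Icc_of_hasFDerivAt_of_le f k _ _ (a, δ) (b, h)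
    ⟨hab, hδh⟩ (fun z hz => (hf' z (hsub hz)).continuousAt.continuousWithinAt)
    (fun z hz => (hk' z (hsub hz)).continuousAt.continuousWithinAt)
    (fun z hz => hf' z (hsub' hz)) (fun z hz => hk' z (hsub' hz)) ?_
  swap
  · refine hEi.congr_fun (fun z hz => ?_) measurableSet_Icc
    have h1 := hdiv z (hsub hz)
    have h2 := hD z (hsub hz)
    simp [hE, h1, h2]
    ring
  rw [setIntegral_congr_fun (g := E) measurableSet_Icc (fun z hz => by
    have h1 := hdiv z (hsub hz)
    have h2 := hD z (hsub hz)
    simp [hE, h1, h2]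
    ring)] at key
  have hvol : (volume : Measure (ℝ × ℝ)).real (Icc (a, δ) (b, h)) = (b - a) * (h - δ) := by
    rw [← Icc_prod_Icc, Measure.volume_eq_prod, measureReal_prod_prod]
    simp [measureReal_def, ENNReal.toReal_ofReal, hab, hδh]
  have hlow : -(L / N * ((b - a) * (h - δ))) ≤ ∫ z in Icc (a, δ) (b, h), E z := by
    have h0 : ∫ z in Icc (a, δ) (b, h), (-(L / N)) ≤ ∫ z in Icc (a, δ) (b, h), E z := by
      refine setIntegral_mono_on ?_ hEi measurableSet_Icc ?_
      · exact continuousOn_const.integrableOn_compact isCompact_Icc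
      · intro z hz
        have h1 := hDl z (hsub hz)
        have h2 : 1 / (1 + (U z / N) ^ 2) ≤ 1 := by
          rw [div_le_one (by positivity)]; nlinarith [sq_nonneg (U z / N)]
        have h3 : 0 ≤ 1 / (1 + (U z / N) ^ 2) := by positivity
        have h4 : 0 < 1 / N := by positivity
        have h5 : -L ≤ 1 / (1 + (U z / N) ^ 2) * D z := by nlinarith
        have : -(L / N) = (1 / N) * (-L) := by ring
        rw [this, hE]
        calc _ ≤ 1 / N * (1 / (1 + (U z / N) ^ 2) * D z) := by gcongr
          _ = _ := by ring
    rw [setIntegral_const, hvol, smul_eq_mul] at h0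
    linarith
  have hfb : ∀ z, ‖f z‖ ≤ 2 := by
    intro z
    have h1 : |arctan (U z / N)| ≤ 2 := by
      rw [abs_le]
      have := arctan_lt_pi_div_two (U z / N)
      have := neg_pi_div_two_lt_arctan (U z / N)
      have := pi_le_four
      constructor <;> linarith
    rw [hf, norm_mul]
    have := hX1 z
    simp only [Real.norm_eq_abs]
    nlinarith [abs_nonneg (X z), abs_nonneg (arctan (U z / N))]
  have s1 : ‖∫ y in δ..h, f (b, y)‖ ≤ 2 * |h - δ| :=
    intervalIntegral.norm_integral_le_of_norm_le_const fun y _ => hfb _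
  have s2 : ‖∫ y in δ..h, f (a, y)‖ ≤ 2 * |h - δ| :=
    intervalIntegral.norm_integral_le_of_norm_le_const fun y _ => hfb _
  rw [abs_of_nonneg (by linarith)] at s1 s2
  rw [Real.norm_eq_abs] at s1 s2
  have := abs_le.1 s1
  have := abs_le.1 s2
  simp only at key
  linarith

lemma arctan_le_self_aux {x : ℝ} (hx : 0 ≤ x) : arctan x ≤ x := by
  rcases hx.eq_or_lt with h | h
  · simp [← h]
  · have h1 : 0 < arctan x := arctan_pos.2 h
    have := Real.lt_tan h1 (arctan_lt_pi_div_two x)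
    rw [tan_arctan] at this
    exact this.le

lemma core_lim (U X Y D : ℝ × ℝ → ℝ) (U' X' Y' : ℝ × ℝ → (ℝ × ℝ →L[ℝ] ℝ)) (L e0 : ℝ) (hL : 0 < L)
    (he0 : 0 < e0)
    (hU : ∀ z ∈ Icc (0:ℝ) 1 ×ˢ Ioo 0 e0, HasFDerivAt U (U' z) z)
    (hX : ∀ z ∈ Icc (0:ℝ) 1 ×ˢ Ioo 0 e0, HasFDerivAt X (X' z) z)
    (hY : ∀ z ∈ Icc (0:ℝ) 1 ×ˢ Ioo 0 e0, HasFDerivAt Y (Y' z) z)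
    (hdiv : ∀ z ∈ Icc (0:ℝ) 1 ×ˢ Ioo 0 e0, X' z (1, 0) = L * Y' z (0, 1))
    (hD : ∀ z ∈ Icc (0:ℝ) 1 ×ˢ Ioo 0 e0,
      D z = U' z (1, 0) * X z + L * U' z (0, 1) * (1 - Y z))
    (hDc : ContinuousOn D (Icc (0:ℝ) 1 ×ˢ Ioo 0 e0))
    (hDl : ∀ z ∈ Icc (0:ℝ) 1 ×ˢ Ioo 0 e0, -L ≤ D z)
    (hX1 : ∀ z, |X z| ≤ 1) (hY1 : ∀ z, |Y z| ≤ 1)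
    (hbv : ∀ s ∈ Ioo (0:ℝ) 1, Tendsto U (𝓝 s ×ˢ 𝓝[>] 0) atTop) :
    Tendsto (fun ε : ℝ => ∫ t in (0:ℝ)..1, Y (t, ε) * L) (𝓝[>] 0) (𝓝 L) := by
  rw [Metric.tendsto_nhds]
  intro η hη
  obtain ⟨κ, hκ0, hκ1, hκ2⟩ : ∃ κ : ℝ, 0 < κ ∧ κ ≤ 1 / 4 ∧ 16 * L * κ ≤ η := by
    refine ⟨min (1 / 4) (η / (16 * L)), by positivity, min_le_left _ _, ?_⟩
    have : min (1 / 4) (η / (16 * L)) ≤ η / (16 * L) := min_le_right _ _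
    rw [le_div_iff₀ (by positivity)] at this
    linarith
  obtain ⟨h, hh0, hh1, hh2⟩ : ∃ h : ℝ, 0 < h ∧ h < e0 ∧ 64 * h ≤ η := by
    refine ⟨min (e0 / 2) (η / 64), by positivity, ?_, ?_⟩
    · have := min_le_left (e0 / 2) (η / 64); linarith
    · have := min_le_right (e0 / 2) (η / 64); linarith
  have hUc : ContinuousOn U (Icc (0:ℝ) 1 ×ˢ Ioo 0 e0) :=
    fun z hz => (hU z hz).continuousAt.continuousWithinAt
  have hYc : ContinuousOn Y (Icc (0:ℝ) 1 ×ˢ Ioo 0 e0) :=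
    fun z hz => (hY z hz).continuousAt.continuousWithinAt
  have slice : ∀ (F : ℝ × ℝ → ℝ), ContinuousOn F (Icc (0:ℝ) 1 ×ˢ Ioo 0 e0) → ∀ y ∈ Ioo 0 e0,
      ContinuousOn (fun s => F (s, y)) (Icc (0:ℝ) 1) := by
    intro F hF y hy
    exact hF.comp (by fun_prop) (fun s hs => ⟨hs, hy⟩)
  obtain ⟨C, hC⟩ := isCompact_Icc.exists_bound_of_continuousOn (slice U hUc h ⟨hh0, hh1⟩)
  have hC0 : 0 ≤ C := (norm_nonneg _).trans (hC 0 (by simp))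
  obtain ⟨N, hN0, hN⟩ : ∃ N : ℝ, 0 < N ∧ L * (2 * C + h) / N ≤ η / 16 := by
    refine ⟨16 * L * (2 * C + h + 1) / η, by positivity, ?_⟩
    rw [div_le_iff₀ (by positivity)]
    have : η / 16 * (16 * L * (2 * C + h + 1) / η) = L * (2 * C + h + 1) := by field_simp
    rw [this]; nlinarith
  have hev : ∀ᶠ ε in 𝓝[>] (0:ℝ), ∀ s ∈ Icc κ (1 - κ), N ≤ U (s, ε) := by
    have h1 : {z : ℝ × ℝ | N ≤ U z} ∈ 𝓝ˢ (Icc κ (1 - κ)) ×ˢ 𝓝[>] (0:ℝ) := by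
      refine isCompact_Icc.mem_nhdsSet_prod_of_forall fun s hs => ?_
      exact (hbv s ⟨by linarith [hs.1], by linarith [hs.2]⟩).eventually_ge_atTop N
    obtain ⟨V, hV, W, hW, hVW⟩ := mem_prod_iff.1 h1
    filter_upwards [hW] with ε hε s hs
    exact hVW (show (s, ε) ∈ V ×ˢ W from ⟨subset_of_mem_nhdsSet hV hs, hε⟩)
  have hδh : ∀ᶠ ε in 𝓝[>] (0:ℝ), ε ∈ Ioo 0 h := Ioo_mem_nhdsGT hh0
  filter_upwards [hev, hδh] with δ hδ hδ1
  have hδe : δ ∈ Ioo 0 e0 := ⟨hδ1.1, hδ1.2.trans hh1⟩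
  have Y0 : ∀ z, 0 ≤ 1 - Y z := fun z => by linarith [(abs_le.1 (hY1 z)).2]
  have Y2 : ∀ z, 1 - Y z ≤ 2 := fun z => by linarith [(abs_le.1 (hY1 z)).1]
  have hYs := slice Y hYc
  have hUs := slice U hUc
  -- integrability
  have ii : ∀ (F : ℝ → ℝ), ContinuousOn F (Icc 0 1) → ∀ a b, 0 ≤ a → a ≤ b → b ≤ 1 →
      IntervalIntegrable F volume a b := by
    intro F hF a b h1 h2 h3
    refine (hF.mono ?_).intervalIntegrable
    rw [uIcc_of_le h2]
    exact Icc_subset_Icc h1 h3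
  have c1 : ContinuousOn (fun s => L * (1 - Y (s, δ))) (Icc 0 1) :=
    continuousOn_const.mul (continuousOn_const.sub (hYs δ hδe))
  have cg : ∀ y ∈ Ioo 0 e0,
      ContinuousOn (fun s => L * (arctan (U (s, y) / N) * (1 - Y (s, y)))) (Icc 0 1) := by
    intro y hy
    exact continuousOn_const.mul ((continuous_arctan.comp_continuousOn ((hUs y hy).div_const N)).mul
      (continuousOn_const.sub (hYs y hy)))
  have m := core_ineq U X Y D U' X' Y' L e0 hL hU hX hY hdiv hD hDc hDl hX1 κ (1 - κ) δ h N
    hκ0.le (by linarith) (by linarith) hδ1.1 hδ1.2.le hh1 hN0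
  have m1 : ∫ s in κ..(1 - κ), (1 / 2) * (L * (1 - Y (s, δ))) ≤
      ∫ s in κ..(1 - κ), L * (arctan (U (s, δ) / N) * (1 - Y (s, δ))) := by
    refine intervalIntegral.integral_mono_on (by linarith)
      ((ii _ c1 _ _ hκ0.le (by linarith) (by linarith)).const_mul _)
      (ii _ (cg δ hδe) _ _ hκ0.le (by linarith) (by linarith)) ?_
    intro s hs
    have h1 : (1:ℝ) ≤ U (s, δ) / N := by
      rw [le_div_iff₀ hN0]; linarith [hδ s hs]
    have h2 := arctan_strictMono.monotone h1
    rw [arctan_one] at h2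
    have h3 : 1 / 2 ≤ arctan (U (s, δ) / N) := by linarith [pi_gt_three]
    have := mul_nonneg hL.le (Y0 (s, δ))
    nlinarith
  have m2 : ∫ s in κ..(1 - κ), L * (arctan (U (s, h) / N) * (1 - Y (s, h))) ≤
      ∫ s in κ..(1 - κ), L * (2 * C / N) := by
    refine intervalIntegral.integral_mono_on (by linarith)
      (ii _ (cg h ⟨hh0, hh1⟩) _ _ hκ0.le (by linarith) (by linarith)) (by simp) ?_
    intro s hs
    have h0 := hC s ⟨by linarith [hs.1], by linarith [hs.2]⟩
    have h1 : arctan (U (s, h) / N) ≤ C / N := by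
      have : U (s, h) / N ≤ C / N := by
        gcongr; exact (le_abs_self _).trans h0
      exact (arctan_strictMono.monotone this).trans (arctan_le_self_aux (by positivity))
    have h2 : arctan (U (s, h) / N) * (1 - Y (s, h)) ≤ C / N * 2 := by
      calc _ ≤ C / N * (1 - Y (s, h)) := by gcongr; exact Y0 _
        _ ≤ _ := by gcongr; exact Y2 _
    have h3 : 2 * C / N = C / N * 2 := by ring
    rw [h3]
    gcongr
  rw [intervalIntegral.integral_const, smul_eq_mul] at m2
  rw [intervalIntegral.integral_const_mul] at m1
  have t1 : ∫ s in (0:ℝ)..κ, L * (1 - Y (s, δ)) ≤ ∫ s in (0:ℝ)..κ, L * 2 := by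
    refine intervalIntegral.integral_mono_on (by linarith)
      (ii _ c1 _ _ (by linarith) (by linarith) (by linarith)) (by simp) ?_
    intro s hs; have := Y2 (s, δ); gcongr
  have t2 : ∫ s in (1 - κ)..1, L * (1 - Y (s, δ)) ≤ ∫ s in (1 - κ)..1, L * 2 := by
    refine intervalIntegral.integral_mono_on (by linarith)
      (ii _ c1 _ _ (by linarith) (by linarith) (by linarith)) (by simp) ?_
    intro s hs; have := Y2 (s, δ); gcongr
  rw [intervalIntegral.integral_const, smul_eq_mul] at t1 t2
  have sp1 := intervalIntegral.integral_add_adjacent_intervals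
    (ii _ c1 0 κ (by linarith) (by linarith) (by linarith))
    (ii _ c1 κ (1 - κ) (by linarith) (by linarith) (by linarith))
  have sp2 := intervalIntegral.integral_add_adjacent_intervals
    (ii _ c1 0 (1 - κ) (by linarith) (by linarith) (by linarith))
    (ii _ c1 (1 - κ) 1 (by linarith) (by linarith) (by linarith))
  have nn : 0 ≤ ∫ s in (0:ℝ)..1, L * (1 - Y (s, δ)) :=
    intervalIntegral.integral_nonneg (by norm_num) fun s _ => mul_nonneg hL.le (Y0 _)
  have eq : ∫ s in (0:ℝ)..1, L * (1 - Y (s, δ)) = L - ∫ s in (0:ℝ)..1, Y (s, δ) * L := by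
    have : ∀ s, L * (1 - Y (s, δ)) = L - Y (s, δ) * L := fun s => by ring
    simp_rw [this]
    have hi : IntervalIntegrable (fun s => Y (s, δ) * L) volume 0 1 :=
      (ii _ (hYs δ hδe) 0 1 le_rfl zero_le_one le_rfl).mul_const L
    have hc : IntervalIntegrable (fun _ : ℝ => L) volume 0 1 := intervalIntegrable_const
    rw [intervalIntegral.integral_sub hc hi]
    simp
  rw [Real.dist_eq, abs_lt]
  have e1 : (1 - κ - κ) * (L * (2 * C / N)) ≤ L * (2 * C / N) := by
    have : 0 ≤ L * (2 * C / N) := by positivity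
    nlinarith
  have e2 : L / N * ((1 - κ - κ) * (h - δ)) ≤ L / N * h := by
    gcongr
    have := hδ1.1; have := hδ1.2
    nlinarith
  have e3 : L * (2 * C + h) / N = L * (2 * C / N) + L / N * h := by ring
  have := hδ1.1
  constructor <;> nlinarith

lemma pd1_eq {u : ℝ × ℝ → ℝ} {z : ℝ × ℝ} {u' : ℝ × ℝ →L[ℝ] ℝ} (h : HasFDerivAt u u' z) :
    pd1 u z = u' (1, 0) := by
  have h2 : HasDerivAt (fun t : ℝ => (t, z.2)) ((1:ℝ), (0:ℝ)) z.1 :=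
    (hasDerivAt_id z.1).prodMk (hasDerivAt_const z.1 z.2)
  have h' : HasFDerivAt u u' (z.1, z.2) := h
  exact (h'.comp_hasDerivAt z.1 h2).deriv

lemma pd2_eq {u : ℝ × ℝ → ℝ} {z : ℝ × ℝ} {u' : ℝ × ℝ →L[ℝ] ℝ} (h : HasFDerivAt u u' z) :
    pd2 u z = u' (0, 1) := by
  have h2 : HasDerivAt (fun t : ℝ => (z.1, t)) ((0:ℝ), (1:ℝ)) z.2 :=
    (hasDerivAt_const z.2 z.1).prodMk (hasDerivAt_id z.2)
  have h' : HasFDerivAt u u' (z.1, z.2) := h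
  exact (h'.comp_hasDerivAt z.2 h2).deriv

lemma clm_apply (F : ℝ × ℝ →L[ℝ] ℝ) (a b : ℝ) : F (a, b) = a * F (1, 0) + b * F (0, 1) := by
  have : ((a, b) : ℝ × ℝ) = a • ((1:ℝ), (0:ℝ)) + b • ((0:ℝ), (1:ℝ)) := by simp
  rw [this, map_add, map_smul, map_smul, smul_eq_mul, smul_eq_mul]

lemma Wg_sq (u : ℝ × ℝ → ℝ) (z : ℝ × ℝ) : Wg u z ^ 2 = 1 + pd1 u z ^ 2 + pd2 u z ^ 2 := by
  rw [Wg, Real.sq_sqrt (by positivity)]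

lemma Wg_ge (u : ℝ × ℝ → ℝ) (z : ℝ × ℝ) : 1 ≤ Wg u z := by
  rw [Wg, Real.one_le_sqrt]; nlinarith [sq_nonneg (pd1 u z), sq_nonneg (pd2 u z)]

lemma field_deriv (Ω : Set (ℝ × ℝ)) (hΩ : IsOpen Ω) (u : ℝ × ℝ → ℝ) (hu : IsMSE u Ω)
    (z : ℝ × ℝ) (hz : z ∈ Ω) :
    ∃ u' P' Q' : ℝ × ℝ →L[ℝ] ℝ, HasFDerivAt u u' z ∧ u' (1, 0) = pd1 u z ∧ u' (0, 1) = pd2 u z ∧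
      ContinuousAt (pd1 u) z ∧ ContinuousAt (pd2 u) z ∧
      HasFDerivAt (fun z => pd1 u z / Wg u z) P' z ∧
      HasFDerivAt (fun z => pd2 u z / Wg u z) Q' z ∧ P' (1, 0) + Q' (0, 1) = 0 := by
  obtain ⟨hc, heq⟩ := hu
  have hcz : ∀ w ∈ Ω, ContDiffAt ℝ 2 u w := fun w hw => hc.contDiffAt (hΩ.mem_nhds hw)
  have hd : ∀ w ∈ Ω, HasFDerivAt u (fderiv ℝ u w) w := fun w hw =>
    ((hcz w hw).differentiableAt (by norm_num)).hasFDerivAt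
  have hd2 : HasFDerivAt (fderiv ℝ u) (fderiv ℝ (fderiv ℝ u) z) z :=
    (((hcz z hz).fderiv_right (m := 1) (by norm_num)).differentiableAt (by norm_num)).hasFDerivAt
  have hsym : IsSymmSndFDerivAt ℝ u z := (hcz z hz).isSymmSndFDerivAt (by simp)
  set H := fderiv ℝ (fderiv ℝ u) z with hH
  have hp : HasFDerivAt (pd1 u) (H.flip (1, 0)) z := by
    have h1 : HasFDerivAt (fun w => fderiv ℝ u w (1, 0)) (H.flip (1, 0)) z := by
      simpa using hd2.clm_apply (hasFDerivAt_const ((1:ℝ), (0:ℝ)) z)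
    refine h1.congr_of_eventuallyEq ?_
    filter_upwards [hΩ.mem_nhds hz] with w hw using pd1_eq (hd w hw)
  have hq : HasFDerivAt (pd2 u) (H.flip (0, 1)) z := by
    have h1 : HasFDerivAt (fun w => fderiv ℝ u w (0, 1)) (H.flip (0, 1)) z := by
      simpa using hd2.clm_apply (hasFDerivAt_const ((0:ℝ), (1:ℝ)) z)
    refine h1.congr_of_eventuallyEq ?_
    filter_upwards [hΩ.mem_nhds hz] with w hw using pd2_eq (hd w hw)
  have hW0 := Wg_ge u z
  have hW2 := Wg_sq u z
  have hWne : Wg u z ≠ 0 := by positivity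
  have hin : 1 + pd1 u z ^ 2 + pd2 u z ^ 2 ≠ 0 := by positivity
  have hW : HasFDerivAt (Wg u) _ z := (((hp.pow 2).const_add 1).add (hq.pow 2)).sqrt hin
  obtain ⟨W', hW', hW'e⟩ : ∃ W' : ℝ × ℝ →L[ℝ] ℝ, HasFDerivAt (Wg u) W' z ∧
      ∀ v, Wg u z * W' v = pd1 u z * H v (1, 0) + pd2 u z * H v (0, 1) := by
    refine ⟨_, hW, fun v => ?_⟩
    have hWd : √(1 + pd1 u z ^ 2 + pd2 u z ^ 2) = Wg u z := rfl
    simp [hWd]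
    field_simp
  have hinv : HasFDerivAt (fun w => (Wg u w)⁻¹) (-(Wg u z ^ 2)⁻¹ • W') z :=
    (hasDerivAt_inv hWne).comp_hasFDerivAt z hW'
  have hE := heq z hz
  rw [pd1_eq hp, pd2_eq hp, pd2_eq hq] at hE
  have hs := hsym (1, 0) (0, 1)
  refine ⟨fderiv ℝ u z, pd1 u z • (-(Wg u z ^ 2)⁻¹ • W') + (Wg u z)⁻¹ • H.flip (1, 0),
    pd2 u z • (-(Wg u z ^ 2)⁻¹ • W') + (Wg u z)⁻¹ • H.flip (0, 1),
    hd z hz, (pd1_eq (hd z hz)).symm, (pd2_eq (hd z hz)).symm,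
    hp.continuousAt, hq.continuousAt, hp.mul hinv, hq.mul hinv, ?_⟩
  have ex := hW'e (1, 0)
  have ey := hW'e (0, 1)
  rw [← hH] at hs
  simp only [ContinuousLinearMap.add_apply, ContinuousLinearMap.smul_apply,
    ContinuousLinearMap.flip_apply, smul_eq_mul] at hE ⊢
  rw [hs] at ex
  generalize H (1, 0) (1, 0) = r at *
  generalize H (0, 1) (1, 0) = s at *
  generalize H (0, 1) (0, 1) = t at *
  generalize W' (1, 0) = a at *
  generalize W' (0, 1) = b at *
  generalize Wg u z = W at *
  generalize pd1 u z = p at *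
  generalize pd2 u z = q at *
  field_simp
  have : W * (-(p * a) + W * r + (-(q * b) + W * t)) = 0 := by
    linear_combination hE - p * ex - q * ey + (r + t) * hW2
  have := (mul_eq_zero.1 this).resolve_left hWne
  linarith

/-- The affine parametrisation of the strip next to the segment. -/
noncomputable def phiL (d n : ℝ × ℝ) : ℝ × ℝ →L[ℝ] ℝ × ℝ :=
  (ContinuousLinearMap.fst ℝ ℝ ℝ).smulRight d - (ContinuousLinearMap.snd ℝ ℝ ℝ).smulRight n

lemma phi_deriv (A d n z : ℝ × ℝ) :
    HasFDerivAt (fun z : ℝ × ℝ => A - z.2 • n + z.1 • d) (phiL d n) z := by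
  have h : (fun z : ℝ × ℝ => A - z.2 • n + z.1 • d) = fun z => A + phiL d n z := by
    funext z; simp only [phiL, ContinuousLinearMap.sub_apply,
      ContinuousLinearMap.smulRight_apply, ContinuousLinearMap.coe_fst',
      ContinuousLinearMap.coe_snd']; abel
  rw [h]
  exact (phiL d n).hasFDerivAt.const_add A

/-- Lemma (Jenkins–Serrin, Lemma 4): if the C² solution `u` of the minimal surfaces
equation takes the boundary value `+∞` on an open straight boundary segment `T` from
`A` to `B`, with constant outer unit normal `ν` (the right-hand normal to
`(B−A)/|B−A|`), then the inward flux of the normalized gradient across `T` equals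
the length `|B−A|` of `T`. -/
theorem flux_across_infinite_segment
    (Ω : Set (ℝ × ℝ)) (hΩ : IsOpen Ω)
    (A B : ℝ × ℝ) (hAB : A ≠ B)
    (ν : ℝ × ℝ)
    (hν : ν = (1 / len (B - A)) • ((B - A).2, -(B - A).1))
    (T : Set (ℝ × ℝ))
    (hT : T = (fun t : ℝ => A + t • (B - A)) '' Ioo 0 1)
    (hTbd : T ⊆ frontier Ω)
    (u : ℝ × ℝ → ℝ) (hu : IsMSE u Ω)
    (hbv : ∀ z ∈ T, Tendsto u (𝓝[Ω] z) atTop)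
    (ε₀ : ℝ) (hε₀ : 0 < ε₀)
    (hin : ∀ ε ∈ Ioo (0:ℝ) ε₀, ∀ t ∈ Icc (0:ℝ) 1, A - ε • ν + t • (B - A) ∈ Ω) :
    Tendsto (fun ε : ℝ => ∫ t in (0:ℝ)..1,
        ((pd1 u (A - ε • ν + t • (B - A)) * ν.1
          + pd2 u (A - ε • ν + t • (B - A)) * ν.2)
          / Wg u (A - ε • ν + t • (B - A))) * len (B - A))
      (𝓝[Ioi 0] 0) (𝓝 (len (B - A))) := by
    classical
  set d := B - A with hd
  set L := len d with hLdef
  have hd2 : 0 < d.1 ^ 2 + d.2 ^ 2 := by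
    have : d ≠ 0 := sub_ne_zero.2 hAB.symm
    by_contra hcon
    apply this
    have h1 : d.1 = 0 := by nlinarith [sq_nonneg d.1, sq_nonneg d.2]
    have h2 : d.2 = 0 := by nlinarith [sq_nonneg d.1, sq_nonneg d.2]
    exact Prod.ext h1 h2
  have hL : 0 < L := Real.sqrt_pos.2 hd2
  have hL2 : L ^ 2 = d.1 ^ 2 + d.2 ^ 2 := Real.sq_sqrt hd2.le
  have hn1 : ν.1 = d.2 / L := by rw [hν]; simp; ring
  have hn2 : ν.2 = -d.1 / L := by rw [hν]; simp; ring
  choose! u' P' Q' hu' hu1 hu2 hpc hqc hP hQ hPQ using field_deriv Ω hΩ u hu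
  set φ : ℝ × ℝ → ℝ × ℝ := fun z => A - z.2 • ν + z.1 • d with hφ
  have hφd : ∀ z, HasFDerivAt φ (phiL d ν) z := phi_deriv A d ν
  have hφΩ : ∀ z ∈ Icc (0:ℝ) 1 ×ˢ Ioo 0 ε₀, φ z ∈ Ω := fun z hz => hin z.2 hz.2 z.1 hz.1
  have hL10 : phiL d ν (1, 0) = (d.1, d.2) := by simp [phiL]
  have hL01 : phiL d ν (0, 1) = (-ν.1, -ν.2) := by
    simp only [phiL, ContinuousLinearMap.sub_apply, ContinuousLinearMap.smulRight_apply,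
      ContinuousLinearMap.coe_fst', ContinuousLinearMap.coe_snd']
    ext <;> simp
  have hW1 := Wg_ge u
  have hW2 := Wg_sq u
  -- the two components of the normalized gradient
  set X0 : ℝ × ℝ → ℝ := fun w =>
    (pd1 u w / Wg u w) * (d.1 / L) + (pd2 u w / Wg u w) * (d.2 / L) with hX0
  set Y0 : ℝ × ℝ → ℝ := fun w =>
    (pd1 u w / Wg u w) * ν.1 + (pd2 u w / Wg u w) * ν.2 with hY0
  have hX0' : ∀ w ∈ Ω, HasFDerivAt X0 ((d.1 / L) • P' w + (d.2 / L) • Q' w) w := fun w hw =>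
    ((hP w hw).mul_const _).add ((hQ w hw).mul_const _)
  have hY0' : ∀ w ∈ Ω, HasFDerivAt Y0 (ν.1 • P' w + ν.2 • Q' w) w := fun w hw =>
    ((hP w hw).mul_const _).add ((hQ w hw).mul_const _)
  have hunit : ∀ w, (pd1 u w / Wg u w) ^ 2 + (pd2 u w / Wg u w) ^ 2 ≤ 1 := by
    intro w
    have := hW1 w
    have := hW2 w
    rw [div_pow, div_pow, ← add_div, div_le_one (by positivity)]
    linarith
  have he : (d.1 / L) ^ 2 + (d.2 / L) ^ 2 = 1 := by
    rw [div_pow, div_pow, ← add_div, ← hL2]; field_simp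
  have hν1 : ν.1 ^ 2 + ν.2 ^ 2 = 1 := by rw [hn1, hn2]; rw [← he]; ring
  have cs : ∀ a b c e : ℝ, a ^ 2 + b ^ 2 ≤ 1 → c ^ 2 + e ^ 2 = 1 → |a * c + b * e| ≤ 1 := by
    intro a b c e h1 h2
    rw [abs_le]
    constructor <;> nlinarith [sq_nonneg (a + c), sq_nonneg (b + e), sq_nonneg (a - c),
      sq_nonneg (b - e)]
  have hX1 : ∀ w, |X0 w| ≤ 1 := fun w => cs _ _ _ _ (hunit w) he
  have hY1 : ∀ w, |Y0 w| ≤ 1 := fun w => cs _ _ _ _ (hunit w) hν1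
  set D0 : ℝ × ℝ → ℝ := fun w => (d.1 * pd1 u w + d.2 * pd2 u w) * X0 w
    + L * (-ν.1 * pd1 u w + -ν.2 * pd2 u w) * (1 - Y0 w) with hD0
  have main := core_lim (fun z => u (φ z)) (fun z => X0 (φ z)) (fun z => Y0 (φ z))
    (fun z => D0 (φ z)) (fun z => (u' (φ z)).comp (phiL d ν))
    (fun z => ((d.1 / L) • P' (φ z) + (d.2 / L) • Q' (φ z)).comp (phiL d ν))
    (fun z => (ν.1 • P' (φ z) + ν.2 • Q' (φ z)).comp (phiL d ν)) L ε₀ hL hε₀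
    (fun z hz => (hu' _ (hφΩ z hz)).comp z (hφd z))
    (fun z hz => (hX0' _ (hφΩ z hz)).comp z (hφd z))
    (fun z hz => (hY0' _ (hφΩ z hz)).comp z (hφd z))
    ?_ ?_ ?_ ?_ (fun z => hX1 _) (fun z => hY1 _) ?_
  · refine main.congr fun ε => ?_
    refine intervalIntegral.integral_congr fun t _ => ?_
    simp only [hY0, hφ]
    ring
  · intro z hz
    have h := hPQ _ (hφΩ z hz)
    simp only [ContinuousLinearMap.comp_apply, hL10, hL01, ContinuousLinearMap.add_apply,
      ContinuousLinearMap.smul_apply, smul_eq_mul]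
    rw [clm_apply (P' (φ z)) d.1, clm_apply (Q' (φ z)) d.1, clm_apply (P' (φ z)) (-ν.1),
      clm_apply (Q' (φ z)) (-ν.1), hn1, hn2]
    field_simp
    linear_combination (d.1 ^ 2 + d.2 ^ 2) * h
  · intro z hz
    simp only [ContinuousLinearMap.comp_apply, hL10, hL01, hD0]
    rw [clm_apply (u' (φ z)) d.1, clm_apply (u' (φ z)) (-ν.1), hu1 _ (hφΩ z hz),
      hu2 _ (hφΩ z hz)]
  · intro z hz
    have hw := hφΩ z hz
    have h1 := hpc _ hw
    have h2 := hqc _ hw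
    have h3 := (hX0' _ hw).continuousAt
    have h4 := (hY0' _ hw).continuousAt
    have h5 : ContinuousAt D0 (φ z) :=
      ((((continuousAt_const.mul h1).add (continuousAt_const.mul h2)).mul h3).add
        ((continuousAt_const.mul ((continuousAt_const.mul h1).add
          (continuousAt_const.mul h2))).mul (continuousAt_const.sub h4)))
    exact (ContinuousAt.comp (f := φ) (x := z) h5 (hφd z).continuousAt).continuousWithinAt
  · intro z hz
    have a1 := hW1 (φ z)
    have a2 := hW2 (φ z)
    have a3 := (abs_le.1 (hY1 (φ z))).2
    have a0 : 0 < Wg u (φ z) := by linarith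
    have e1 : D0 (φ z) = L * (Wg u (φ z) * (1 - Y0 (φ z)) - 1 / Wg u (φ z)) := by
      simp only [hD0, hX0, hY0, hn1, hn2]
      generalize Wg u (φ z) = W at *
      generalize pd1 u (φ z) = p at *
      generalize pd2 u (φ z) = q at *
      field_simp
      linear_combination (-(p ^ 2 + q ^ 2)) * hL2 - L ^ 2 * a2
    rw [e1]
    have b1 : 1 / Wg u (φ z) ≤ 1 := by rw [div_le_one a0]; exact a1
    have b2 : 0 ≤ Wg u (φ z) * (1 - Y0 (φ z)) := mul_nonneg a0.le (by linarith)
    nlinarith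
  · intro s hs
    have hz : A + s • d ∈ T := by rw [hT]; exact ⟨s, hs, rfl⟩
    refine (hbv _ hz).comp (tendsto_nhdsWithin_iff.2 ⟨?_, ?_⟩)
    · have h1 : Tendsto φ (𝓝 (s, 0)) (𝓝 (A + s • d)) := by
        have := (hφd (s, 0)).continuousAt.tendsto
        simpa [hφ] using this
      refine h1.mono_left ?_
      rw [nhds_prod_eq]
      exact prod_mono le_rfl nhdsWithin_le_nhds
    · have : Icc (0:ℝ) 1 ×ˢ Ioo 0 ε₀ ∈ 𝓝 s ×ˢ 𝓝[>] (0:ℝ) :=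
        prod_mem_prod (Icc_mem_nhds hs.1 hs.2) (Ioo_mem_nhdsGT hε₀)
      filter_upwards [this] with z hz using hφΩ z hz
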